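/- Let σ be an absolutely continuous probability measure on ℝⁿ with finite second moment and μ a probability measure on ℝⁿ with finite second moment. Then for every P ∈ O(n), W₂((T_{σ,μ;P})_♯σ, μ) ≤ 2 · inf{ W₂((x ↦ ax + b)_♯σ, μ) : a > 0, b ∈ ℝⁿ }. -/

import Mathlib

open MeasureTheory Filter
open scoped ENNReal RealInnerProductSpace BigOperators Topology

noncomputable section

namespace SliceMatching

/-- `ℝⁿ` with its Euclidean structure. -/
abbrev Rn (n : ℕ) := EuclideanSpace ℝ (Fin n)

/-- The cumulative distribution function of a measure on `ℝ`. -/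
def cdf (ν : Measure ℝ) (t : ℝ) : ℝ := (ν (Set.Iic t)).toReal

/-- The quantile function (pseudo-inverse of the CDF) of a measure on `ℝ`. -/
def quantile (ρ : Measure ℝ) (p : ℝ) : ℝ := sInf {t : ℝ | p ≤ cdf ρ t}

/-- The one-dimensional optimal transport map `T_ν^ρ = F_ρ⁻¹ ∘ F_ν`. -/
def otMap1d (ν ρ : Measure ℝ) (t : ℝ) : ℝ := quantile ρ (cdf ν t)

/-- The slice `σ^θ`: pushforward of `σ` under the projection `x ↦ ⟪x, θ⟫`. -/
def slice {n : ℕ} (σ : Measure (Rn n)) (θ : Rn n) : Measure ℝ :=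
  σ.map (fun x => ⟪x, θ⟫)

/-- The matrix-slice matching map `T_{σ,μ;P}`, where `P ∈ O(n)` has columns `θ 0, …, θ (n-1)`:
`T_{σ,μ;P}(x) = ∑ i, T_{σ^{θ i}}^{μ^{θ i}}(⟪x, θ i⟫) • θ i`. -/
def smMap {n : ℕ} (σ μ : Measure (Rn n)) (θ : Fin n → Rn n) (x : Rn n) : Rn n :=
  ∑ i, otMap1d (slice σ (θ i)) (slice μ (θ i)) ⟪x, θ i⟫ • θ i

/-- The squared quadratic Wasserstein distance: the infimum of `∫ ‖x - y‖²` over all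
couplings of `σ` and `μ`. -/
def W2sq {α : Type*} [MeasurableSpace α] [NormedAddCommGroup α] (σ μ : Measure α) : ℝ :=
  (⨅ (π : Measure (α × α)) (_ : π.map Prod.fst = σ ∧ π.map Prod.snd = μ),
    ∫⁻ p, ENNReal.ofReal (‖p.1 - p.2‖ ^ 2) ∂π).toReal

/-- The quadratic Wasserstein distance `W₂`. -/
def W2 {α : Type*} [MeasurableSpace α] [NormedAddCommGroup α] (σ μ : Measure α) : ℝ :=
  Real.sqrt (W2sq σ μ)

section Cdf

variable (ν : Measure ℝ)

lemma cdf_eq_cdf [IsProbabilityMeasure ν] : cdf ν = ProbabilityTheory.cdf ν := by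
  ext x
  rw [ProbabilityTheory.cdf_eq_real]
  rfl

lemma monotone_cdf [IsProbabilityMeasure ν] : Monotone (cdf ν) := by
  rw [cdf_eq_cdf]
  exact ProbabilityTheory.monotone_cdf ν

lemma cdf_nonneg (x : ℝ) : 0 ≤ cdf ν x := ENNReal.toReal_nonneg

lemma cdf_le_one [IsProbabilityMeasure ν] (x : ℝ) : cdf ν x ≤ 1 := by
  rw [cdf_eq_cdf]
  exact ProbabilityTheory.cdf_le_one ν x

lemma tendsto_cdf_atBot [IsProbabilityMeasure ν] : Tendsto (cdf ν) atBot (𝓝 0) := by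
  rw [cdf_eq_cdf]
  exact ProbabilityTheory.tendsto_cdf_atBot ν

lemma tendsto_cdf_atTop [IsProbabilityMeasure ν] : Tendsto (cdf ν) atTop (𝓝 1) := by
  rw [cdf_eq_cdf]
  exact ProbabilityTheory.tendsto_cdf_atTop ν

lemma ofReal_cdf [IsProbabilityMeasure ν] (x : ℝ) :
    ENNReal.ofReal (cdf ν x) = ν (Set.Iic x) :=
  ENNReal.ofReal_toReal (measure_ne_top _ _)

lemma continuous_cdf [IsProbabilityMeasure ν] [NullSingletonClass ν] : Continuous (cdf ν) := by
  rw [cdf_eq_cdf, continuous_iff_continuousAt]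
  intro x
  have hmono := ProbabilityTheory.monotone_cdf ν
  rw [hmono.continuousAt_iff_leftLim_eq_rightLim, StieltjesFunction.rightLim_eq]
  have h := (ProbabilityTheory.cdf ν).measure_singleton x
  rw [ProbabilityTheory.measure_cdf, measure_singleton, eq_comm, ENNReal.ofReal_eq_zero] at h
  exact le_antisymm (hmono.leftLim_le le_rfl) (by linarith)

lemma exists_cdf_eq [IsProbabilityMeasure ν] [NullSingletonClass ν] {p : ℝ}
    (h0 : 0 < p) (h1 : p < 1) :
    ∃ x, cdf ν x = p :=
  mem_range_of_exists_le_of_exists_ge (continuous_cdf ν)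
    ((tendsto_cdf_atBot ν).eventually_le_const h0).exists
    ((tendsto_cdf_atTop ν).eventually_const_le h1).exists

lemma measure_cdf_le [IsProbabilityMeasure ν] [NullSingletonClass ν] {p : ℝ}
    (h0 : 0 ≤ p) (h1 : p ≤ 1) :
    ν {x | cdf ν x ≤ p} = ENNReal.ofReal p := by
  rcases h1.eq_or_lt with rfl | h1
  · simp [cdf_le_one]
  apply le_antisymm
  · have hlim : Tendsto ENNReal.ofReal (𝓝[>] p) (𝓝 (ENNReal.ofReal p)) :=
      ENNReal.continuous_ofReal.continuousAt.mono_left nhdsWithin_le_nhds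
    refine ge_of_tendsto hlim ?_
    filter_upwards [Ioo_mem_nhdsGT h1] with q hq
    obtain ⟨x, hx⟩ := exists_cdf_eq ν (h0.trans_lt hq.1) hq.2
    rw [← hx, ofReal_cdf]
    refine measure_mono fun y (hy : cdf ν y ≤ p) ↦ ?_
    by_contra hyx
    have := monotone_cdf ν (not_le.mp hyx).le
    linarith [hq.1]
  · rcases h0.eq_or_lt with rfl | h0
    · simp
    obtain ⟨x, rfl⟩ := exists_cdf_eq ν h0 h1
    rw [ofReal_cdf]
    exact measure_mono fun y hy ↦ monotone_cdf ν hy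

lemma ae_cdf_mem_Ioo [IsProbabilityMeasure ν] [NullSingletonClass ν] :
    ∀ᵐ x ∂ν, cdf ν x ∈ Set.Ioo 0 1 := by
  have hpos : ∀ᵐ x ∂ν, 0 < cdf ν x := by
    have h := measure_cdf_le ν le_rfl zero_le_one
    simpa [ae_iff] using h
  have hlt : ∀ᵐ x ∂ν, cdf ν x < 1 := by
    have hmeas : MeasurableSet {x | cdf ν x < 1} :=
      measurableSet_lt (monotone_cdf ν).measurable measurable_const
    refine (mem_ae_iff_prob_eq_one hmeas).mpr (le_antisymm prob_le_one ?_)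
    have hlim : Tendsto ENNReal.ofReal (𝓝[<] 1) (𝓝 (ENNReal.ofReal 1)) :=
      ENNReal.continuous_ofReal.continuousAt.mono_left nhdsWithin_le_nhds
    rw [← ENNReal.ofReal_one]
    refine le_of_tendsto hlim ?_
    filter_upwards [Ioo_mem_nhdsLT zero_lt_one] with q hq
    rw [← measure_cdf_le ν hq.1.le hq.2.le]
    exact measure_mono fun x (hx : cdf ν x ≤ q) ↦ hx.trans_lt hq.2
  filter_upwards [hpos, hlt] with x h1 h2 using ⟨h1, h2⟩

end Cdf

section Quantile

variable (ρ : Measure ℝ)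

lemma quantile_le_iff [IsProbabilityMeasure ρ] {p t : ℝ} (hp : p ∈ Set.Ioo 0 1) :
    quantile ρ p ≤ t ↔ p ≤ cdf ρ t := by
  have hbdd : BddBelow {t : ℝ | p ≤ cdf ρ t} := by
    obtain ⟨m, hm⟩ := ((tendsto_cdf_atBot ρ).eventually_lt_const hp.1).exists
    refine ⟨m, fun t (ht : p ≤ cdf ρ t) ↦ ?_⟩
    by_contra h
    have := monotone_cdf ρ (not_le.mp h).le
    linarith
  have hne : {t : ℝ | p ≤ cdf ρ t}.Nonempty :=
    ((tendsto_cdf_atTop ρ).eventually_const_le hp.2).exists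
  refine ⟨fun h ↦ ?_, fun h ↦ csInf_le hbdd h⟩
  have hlim : Tendsto (cdf ρ) (𝓝[>] t) (𝓝 (cdf ρ t)) := by
    rw [cdf_eq_cdf]
    exact ((ProbabilityTheory.cdf ρ).right_continuous t).mono Set.Ioi_subset_Ici_self
  refine ge_of_tendsto hlim ?_
  filter_upwards [self_mem_nhdsWithin] with u hu
  obtain ⟨s, hs, hsu⟩ := exists_lt_of_csInf_lt hne (h.trans_lt hu)
  exact le_trans hs (monotone_cdf ρ hsu.le)

lemma monotoneOn_quantile [IsProbabilityMeasure ρ] : MonotoneOn (quantile ρ) (Set.Ioo 0 1) := by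
  intro p hp q hq hpq
  rw [quantile_le_iff ρ hp]
  exact hpq.trans ((quantile_le_iff ρ hq).mp le_rfl)

lemma quantile_of_nonpos {p : ℝ} (hp : p ≤ 0) : quantile ρ p = 0 := by
  have : {t : ℝ | p ≤ cdf ρ t} = Set.univ :=
    Set.eq_univ_of_forall fun t ↦ hp.trans (cdf_nonneg ρ t)
  rw [quantile, this, Real.sInf_univ]

lemma quantile_of_one_lt [IsProbabilityMeasure ρ] {p : ℝ} (hp : 1 < p) : quantile ρ p = 0 := by
  have : {t : ℝ | p ≤ cdf ρ t} = ∅ :=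
    Set.eq_empty_of_forall_notMem fun t ht ↦ (hp.trans_le ht).not_ge (cdf_le_one ρ t)
  rw [quantile, this, Real.sInf_empty]

lemma measurable_quantile [IsProbabilityMeasure ρ] : Measurable (quantile ρ) := by
  refine measurable_of_Iic fun t ↦ ?_
  have : quantile ρ ⁻¹' Set.Iic t =
      (Set.Ioo 0 1 ∩ Set.Iic (cdf ρ t)) ∪ ((Set.Iic 0 ∪ Set.Ioi 1) ∩ {_p : ℝ | (0 : ℝ) ≤ t}) ∪
        ({1} ∩ {_p : ℝ | quantile ρ 1 ≤ t}) := by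
    ext p
    simp only [Set.mem_preimage, Set.mem_Iic, Set.mem_union, Set.mem_inter_iff, Set.mem_Ioo,
      Set.mem_Ioi, Set.mem_singleton_iff, Set.mem_ofPred_eq]
    rcases le_or_gt p 0 with h0 | h0
    · have h1 : p ≠ 1 := by linarith
      simp [quantile_of_nonpos ρ h0, h0, h0.not_gt, h1]
    rcases lt_trichotomy p 1 with h1 | rfl | h1
    · simp [quantile_le_iff ρ ⟨h0, h1⟩, h0, h0.not_ge, h1, h1.ne, h1.not_gt]
    · simp
    · simp [quantile_of_one_lt ρ h1, h1, h1.ne', h1.not_gt]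
  rw [this]
  exact ((measurableSet_Ioo.inter measurableSet_Iic).union
    ((measurableSet_Iic.union measurableSet_Ioi).inter (.const _))).union
    ((measurableSet_singleton _).inter (.const _))

lemma measurable_otMap1d (ν : Measure ℝ) [IsProbabilityMeasure ρ] [IsProbabilityMeasure ν] :
    Measurable (otMap1d ν ρ) :=
  (measurable_quantile ρ).comp (monotone_cdf ν).measurable

lemma map_otMap1d (ν : Measure ℝ) [IsProbabilityMeasure ρ] [IsProbabilityMeasure ν]
    [NullSingletonClass ν] :
    ν.map (otMap1d ν ρ) = ρ := by
  have := Measure.isProbabilityMeasure_map (μ := ν) (measurable_otMap1d ρ ν).aemeasurable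
  refine Measure.ext_of_Iic _ _ fun t ↦ ?_
  rw [Measure.map_apply (measurable_otMap1d ρ ν) measurableSet_Iic, ← ofReal_cdf ρ,
    ← measure_cdf_le ν (cdf_nonneg ρ t) (cdf_le_one ρ t)]
  refine measure_congr ?_
  filter_upwards [ae_cdf_mem_Ioo ν] with x hx
  exact propext (quantile_le_iff ρ hx)

lemma monotoneOn_otMap1d (ν : Measure ℝ) [IsProbabilityMeasure ρ] [IsProbabilityMeasure ν] :
    MonotoneOn (otMap1d ν ρ) {x | cdf ν x ∈ Set.Ioo 0 1} :=
  fun _ hx _ hy hxy ↦ monotoneOn_quantile ρ hx hy (monotone_cdf ν hxy)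

end Quantile

section Comonotone

variable {Ω : Type*} [MeasurableSpace Ω]

lemma ofReal_sub_sq_eq_lintegral (u y : ℝ) :
    ENNReal.ofReal ((u - y) ^ 2) = ∫⁻ s : ℝ × ℝ,
      ({s : ℝ × ℝ | y ≤ min s.1 s.2 ∧ max s.1 s.2 < u}.indicator 1 s +
        {s : ℝ × ℝ | u ≤ min s.1 s.2 ∧ max s.1 s.2 < y}.indicator 1 s) := by
  have key (a b : ℝ) :
      {s : ℝ × ℝ | a ≤ min s.1 s.2 ∧ max s.1 s.2 < b} = Set.Ico a b ×ˢ Set.Ico a b := by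
    ext s
    simp only [le_inf_iff, sup_lt_iff, Set.mem_ofPred_eq, Set.mem_prod, Set.mem_Ico]
    tauto
  have hm (a b : ℝ) : MeasurableSet (Set.Ico a b ×ˢ Set.Ico a b) :=
    measurableSet_Ico.prod measurableSet_Ico
  simp only [key]
  rw [lintegral_add_left (measurable_one.indicator (hm y u)), lintegral_indicator_one (hm y u),
    lintegral_indicator_one (hm u y), Measure.volume_eq_prod, Measure.prod_prod, Measure.prod_prod,
    Real.volume_Ico, Real.volume_Ico]
  rcases le_total u y with h | h
  · rw [ENNReal.ofReal_of_nonpos (sub_nonpos.mpr h), zero_mul, zero_add,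
      ← ENNReal.ofReal_mul (sub_nonneg.mpr h)]
    congr 1
    ring
  · rw [ENNReal.ofReal_of_nonpos (sub_nonpos.mpr h), zero_mul, add_zero,
      ← ENNReal.ofReal_mul (sub_nonneg.mpr h)]
    congr 1
    ring

lemma lintegral_sub_sq_eq (P : Measure Ω) [SFinite P] {U Y : Ω → ℝ} (hU : Measurable U)
    (hY : Measurable Y) :
    ∫⁻ ω, ENNReal.ofReal ((U ω - Y ω) ^ 2) ∂P = ∫⁻ s : ℝ × ℝ,
      (P ({ω | Y ω ≤ min s.1 s.2} \ {ω | U ω ≤ max s.1 s.2}) +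
        P ({ω | U ω ≤ min s.1 s.2} \ {ω | Y ω ≤ max s.1 s.2})) := by
  have hmeas {A B : Ω → ℝ} (hA : Measurable A) (hB : Measurable B) :
      MeasurableSet {q : Ω × ℝ × ℝ | A q.1 ≤ min q.2.1 q.2.2 ∧ max q.2.1 q.2.2 < B q.1} := by
    have h1 : MeasurableSet {q : Ω × ℝ × ℝ | A q.1 ≤ min q.2.1 q.2.2} :=
      measurableSet_le (by fun_prop) (by fun_prop)
    have h2 : MeasurableSet {q : Ω × ℝ × ℝ | max q.2.1 q.2.2 < B q.1} :=
      measurableSet_lt (by fun_prop) (by fun_prop)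
    exact h1.inter h2
  have hm1 := hmeas hY hU
  have hm2 := hmeas hU hY
  simp_rw [ofReal_sub_sq_eq_lintegral]
  rw [lintegral_lintegral_swap]
  · refine lintegral_congr fun s ↦ ?_
    have hs {A B : Ω → ℝ} (hA : Measurable A) (hB : Measurable B) :
        MeasurableSet ({ω | A ω ≤ min s.1 s.2} \ {ω | B ω ≤ max s.1 s.2}) :=
      (measurableSet_le hA measurable_const).diff (measurableSet_le hB measurable_const)
    rw [← lintegral_indicator_one (hs hY hU), ← lintegral_indicator_one (hs hU hY),
      ← lintegral_add_left (measurable_one.indicator (hs hY hU))]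
    refine lintegral_congr fun ω ↦ ?_
    simp [Set.indicator_apply]
  · exact ((measurable_one.indicator hm1).add (measurable_one.indicator hm2)).aemeasurable

/-- If `A` and `B` are nested up to null sets, then `A \ B` has the least measure among all
`A' \ B'` with `P A' = P A` and `P B' = P B`. -/
lemma measure_sdiff_le_of_nested (P : Measure Ω) [IsFiniteMeasure P] {A B A' B' : Set Ω}
    (hA : P A = P A') (hB : P B = P B') (hBm : MeasurableSet B)
    (h : A ≤ᵐ[P] B ∨ B ≤ᵐ[P] A) : P (A \ B) ≤ P (A' \ B') := by
  rcases h with h | h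
  · rw [ae_le_set.mp h]
    exact zero_le
  · rw [measure_sdiff' A hBm.nullMeasurableSet (measure_ne_top _ _)]
    have : P (A ∪ B) = P A := measure_congr (union_ae_eq_left_iff_ae_subset.mpr h)
    rw [this, hA, hB]
    exact le_measure_sdiff

lemma lintegral_sub_sq_le_of_comonotone (P : Measure Ω) [IsFiniteMeasure P] {U V Y : Ω → ℝ}
    (hU : Measurable U) (hV : Measurable V) (hY : Measurable Y) (hVY : P.map V = P.map Y)
    {G : Set Ω} (hG : ∀ᵐ ω ∂P, ω ∈ G) (hmono : ∀ ω ∈ G, ∀ ω' ∈ G, U ω < U ω' → V ω ≤ V ω') :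
    ∫⁻ ω, ENNReal.ofReal ((U ω - V ω) ^ 2) ∂P ≤ ∫⁻ ω, ENNReal.ofReal ((U ω - Y ω) ^ 2) ∂P := by
  have hlaw (t : ℝ) : P {ω | V ω ≤ t} = P {ω | Y ω ≤ t} := by
    have h := congrArg (fun m : Measure ℝ ↦ m (Set.Iic t)) hVY
    simp only [Measure.map_apply hV measurableSet_Iic, Measure.map_apply hY measurableSet_Iic] at h
    exact h
  have hnest (s t : ℝ) : {ω | V ω ≤ s} ≤ᵐ[P] {ω | U ω ≤ t} ∨
      {ω | U ω ≤ t} ≤ᵐ[P] {ω | V ω ≤ s} := by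
    by_cases hc : ∀ ω ∈ G, V ω ≤ s → U ω ≤ t
    · left
      filter_upwards [hG] with ω hω using hc ω hω
    · right
      push Not at hc
      obtain ⟨ω', hω', h1, h2⟩ := hc
      filter_upwards [hG] with ω hω
      intro (h : U ω ≤ t)
      exact (hmono ω hω ω' hω' (h.trans_lt h2)).trans h1
  rw [lintegral_sub_sq_eq P hU hV, lintegral_sub_sq_eq P hU hY]
  refine lintegral_mono fun s ↦ add_le_add ?_ ?_
  · exact measure_sdiff_le_of_nested P (hlaw _) rfl (measurableSet_le hU measurable_const)
      (hnest _ _)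
  · exact measure_sdiff_le_of_nested P rfl (hlaw _) (measurableSet_le hV measurable_const)
      (hnest _ _).symm

end Comonotone

section Euclidean

variable {n : ℕ}

lemma exists_orthonormalBasis_coe_eq {θ : Fin n → Rn n} (hθ : Orthonormal ℝ θ) :
    ∃ b : OrthonormalBasis (Fin n) ℝ (Rn n), ⇑b = θ :=
  ⟨.mk hθ (hθ.linearIndependent.span_eq_top_of_card_eq_finrank' (by simp)).ge,
    OrthonormalBasis.coe_mk _ _⟩

lemma nullSingletonClass_slice {σ : Measure (Rn n)} (hac : σ ≪ volume) {v : Rn n} (hv : v ≠ 0) :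
    NullSingletonClass (slice σ v) := by
  refine ⟨fun c ↦ ?_⟩
  rw [slice, Measure.map_apply (by fun_prop) (measurableSet_singleton c)]
  apply hac
  let H : AffineSubspace ℝ (Rn n) :=
    { carrier := {x | ⟪x, v⟫ = c}
      smul_vsub_vadd_mem' := fun r x y z (hx : ⟪x, v⟫ = c) (hy : ⟪y, v⟫ = c) (hz : ⟪z, v⟫ = c) ↦ by
        simp [inner_add_left, inner_sub_left, real_inner_smul_left, hx, hy, hz] }
  refine Measure.addHaar_affineSubspace volume H fun hH ↦ hv ?_
  have hmem (x : Rn n) : ⟪x, v⟫ = c := by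
    have hx : x ∈ H := hH ▸ AffineSubspace.mem_top ℝ _ x
    exact hx
  rw [← inner_self_eq_zero (𝕜 := ℝ), hmem v, ← hmem 0, inner_zero_left]

instance isProbabilityMeasure_slice (σ : Measure (Rn n)) [IsProbabilityMeasure σ] (v : Rn n) :
    IsProbabilityMeasure (slice σ v) :=
  Measure.isProbabilityMeasure_map (by fun_prop)

lemma measurable_smMap (σ μ : Measure (Rn n)) [IsProbabilityMeasure σ] [IsProbabilityMeasure μ]
    (θ : Fin n → Rn n) : Measurable (smMap σ μ θ) := by
  refine Finset.measurable_sum _ fun i _ ↦ Measurable.smul_const ?_ _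
  exact (measurable_otMap1d _ _).comp (by fun_prop)

lemma ofReal_norm_sub_sq {θ : Fin n → Rn n} (hθ : Orthonormal ℝ θ) (x y : Rn n) :
    ENNReal.ofReal (‖x - y‖ ^ 2) = ∑ i, ENNReal.ofReal ((⟪x, θ i⟫ - ⟪y, θ i⟫) ^ 2) := by
  obtain ⟨b, rfl⟩ := exists_orthonormalBasis_coe_eq hθ
  rw [← ENNReal.ofReal_sum_of_nonneg fun _ _ ↦ sq_nonneg _, ← b.sum_sq_inner_left]
  simp_rw [inner_sub_left]

lemma inner_smMap (σ μ : Measure (Rn n)) {θ : Fin n → Rn n} (hθ : Orthonormal ℝ θ) (x : Rn n)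
    (i : Fin n) :
    ⟪smMap σ μ θ x, θ i⟫ = otMap1d (slice σ (θ i)) (slice μ (θ i)) ⟪x, θ i⟫ := by
  exact hθ.inner_left_fintype
    (fun i ↦ otMap1d (slice σ (θ i)) (slice μ (θ i)) ⟪x, θ i⟫) i

/-- Among all random vectors with law `μ`, the slice matching image of `X ∼ σ` is at least as
close in `L²` to `a • X + b`, provided `a > 0`. -/
lemma lintegral_norm_sub_smMap_le {Ω : Type*} [MeasurableSpace Ω] (P : Measure Ω)
    (σ μ : Measure (Rn n)) [IsProbabilityMeasure σ] [IsProbabilityMeasure μ] (hac : σ ≪ volume)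
    {θ : Fin n → Rn n} (hθ : Orthonormal ℝ θ) {X Y : Ω → Rn n} (hX : Measurable X)
    (hY : Measurable Y) (hXσ : P.map X = σ) (hYμ : P.map Y = μ) {a : ℝ} (ha : 0 < a) (b : Rn n) :
    ∫⁻ ω, ENNReal.ofReal (‖(a • X ω + b) - smMap σ μ θ (X ω)‖ ^ 2) ∂P ≤
      ∫⁻ ω, ENNReal.ofReal (‖(a • X ω + b) - Y ω‖ ^ 2) ∂P := by
  have : IsProbabilityMeasure P := by
    refine (Measure.isProbabilityMeasure_map_iff hX.aemeasurable).mp ?_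
    rwa [hXσ]
  have hT := measurable_smMap σ μ θ
  simp_rw [ofReal_norm_sub_sq hθ]
  rw [lintegral_finsetSum _ (fun i _ ↦ by fun_prop), lintegral_finsetSum _ (fun i _ ↦ by fun_prop)]
  refine Finset.sum_le_sum fun i _ ↦ ?_
  have := nullSingletonClass_slice hac (hθ.ne_zero i)
  have hXi : P.map (fun ω ↦ ⟪X ω, θ i⟫) = slice σ (θ i) := by
    rw [slice, ← hXσ, Measure.map_map (by fun_prop) hX]
    rfl
  have hYi : P.map (fun ω ↦ ⟪Y ω, θ i⟫) = slice μ (θ i) := by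
    rw [slice, ← hYμ, Measure.map_map (by fun_prop) hY]
    rfl
  have hTm := measurable_otMap1d (slice μ (θ i)) (slice σ (θ i))
  refine lintegral_sub_sq_le_of_comonotone P (by fun_prop) (by fun_prop) (by fun_prop) ?_
    (G := {ω | cdf (slice σ (θ i)) ⟪X ω, θ i⟫ ∈ Set.Ioo 0 1}) ?_ ?_
  · simp_rw [inner_smMap σ μ hθ]
    have h := (Measure.map_map (μ := P) (f := fun ω ↦ ⟪X ω, θ i⟫) hTm (by fun_prop)).symm
    rw [hXi, map_otMap1d] at h
    rw [hYi]
    exact h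
  · exact ae_of_ae_map (p := fun x ↦ cdf (slice σ (θ i)) x ∈ Set.Ioo 0 1)
      (f := fun ω ↦ ⟪X ω, θ i⟫) (by fun_prop) (by rw [hXi]; exact ae_cdf_mem_Ioo _)
  · intro ω hω ω' hω' h
    rw [inner_smMap σ μ hθ, inner_smMap σ μ hθ]
    refine monotoneOn_otMap1d _ _ hω hω' ?_
    simp only [inner_add_left, real_inner_smul_left, add_lt_add_iff_right] at h
    exact (lt_of_mul_lt_mul_left h ha.le).le

lemma ofReal_norm_sub_sq_le {E : Type*} [SeminormedAddCommGroup E] (x y z : E) :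
    ENNReal.ofReal (‖x - z‖ ^ 2) ≤
      2 * ENNReal.ofReal (‖y - x‖ ^ 2) + 2 * ENNReal.ofReal (‖y - z‖ ^ 2) := by
  rw [← ENNReal.ofReal_ofNat 2, ← ENNReal.ofReal_mul zero_le_two, ← ENNReal.ofReal_mul zero_le_two,
    ← ENNReal.ofReal_add (by positivity) (by positivity)]
  refine ENNReal.ofReal_le_ofReal ?_
  have h : ‖x - z‖ ≤ ‖y - x‖ + ‖y - z‖ := by
    rw [norm_sub_rev y x]
    exact norm_sub_le_norm_sub_add_norm_sub x y z
  nlinarith [norm_nonneg (x - z), sq_nonneg (‖y - x‖ - ‖y - z‖)]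

/-- The product coupling of two measures with finite second moments has finite cost. -/
lemma lintegral_prod_norm_sub_sq_ne_top {α β : Measure (Rn n)} [IsProbabilityMeasure α]
    [IsProbabilityMeasure β] (hα : Integrable (fun x ↦ ‖x‖ ^ 2) α)
    (hβ : Integrable (fun y ↦ ‖y‖ ^ 2) β) :
    ∫⁻ p, ENNReal.ofReal (‖p.1 - p.2‖ ^ 2) ∂(α.prod β) ≠ ∞ := by
  have hint : Integrable (fun p : Rn n × Rn n ↦ 2 * ‖p.1‖ ^ 2 + 2 * ‖p.2‖ ^ 2) (α.prod β) :=
    ((hα.comp_fst β).const_mul 2).add ((hβ.comp_snd α).const_mul 2)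
  refine ne_top_of_le_ne_top hint.lintegral_lt_top.ne
    (lintegral_mono fun p ↦ ENNReal.ofReal_le_ofReal ?_)
  have := norm_sub_le p.1 p.2
  nlinarith [norm_nonneg (p.1 - p.2), sq_nonneg (‖p.1‖ - ‖p.2‖)]

lemma integrable_norm_sq_map_affine {σ : Measure (Rn n)} [IsProbabilityMeasure σ]
    (hσ : Integrable (fun x ↦ ‖x‖ ^ 2) σ) (a : ℝ) (b : Rn n) :
    Integrable (fun x ↦ ‖x‖ ^ 2) (σ.map fun x ↦ a • x + b) := by
  rw [integrable_map_measure (by fun_prop) (by fun_prop)]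
  have hint : Integrable (fun x ↦ 2 * (a ^ 2 * ‖x‖ ^ 2) + 2 * ‖b‖ ^ 2) σ :=
    ((hσ.const_mul _).const_mul _).add (integrable_const _)
  refine hint.mono' (by fun_prop) (ae_of_all _ fun x ↦ ?_)
  have h := norm_add_le (a • x) b
  have ha : ‖a • x‖ ^ 2 = a ^ 2 * ‖x‖ ^ 2 := by
    rw [norm_smul, mul_pow, Real.norm_eq_abs, sq_abs]
  simp only [Function.comp_apply, norm_pow, norm_norm]
  nlinarith [norm_nonneg (a • x + b), sq_nonneg (‖a • x‖ - ‖b‖)]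

lemma W2_map_smMap_le {σ μ : Measure (Rn n)} [IsProbabilityMeasure σ] [IsProbabilityMeasure μ]
    (hac : σ ≪ volume) (hσ2 : Integrable (fun x ↦ ‖x‖ ^ 2) σ)
    (hμ2 : Integrable (fun y ↦ ‖y‖ ^ 2) μ) {θ : Fin n → Rn n} (hθ : Orthonormal ℝ θ)
    {a : ℝ} (ha : 0 < a) (b : Rn n) :
    W2 (σ.map (smMap σ μ θ)) μ ≤ 2 * W2 (σ.map fun x ↦ a • x + b) μ := by
  have hT := measurable_smMap σ μ θ
  have hS : Measurable fun x : Rn n ↦ a • x + b := by fun_prop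
  have : IsProbabilityMeasure (σ.map fun x ↦ a • x + b) :=
    Measure.isProbabilityMeasure_map hS.aemeasurable
  suffices h : W2sq (σ.map (smMap σ μ θ)) μ ≤ 4 * W2sq (σ.map fun x ↦ a • x + b) μ by
    rw [W2, W2]
    refine Real.sqrt_le_iff.mpr ⟨by positivity, h.trans_eq ?_⟩
    rw [mul_pow, Real.sq_sqrt (by exact ENNReal.toReal_nonneg)]
    norm_num
  rw [W2sq, W2sq, ← ENNReal.toReal_ofNat 4, ← ENNReal.toReal_mul]
  refine ENNReal.toReal_mono (ENNReal.mul_ne_top (by simp) ?_) ?_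
  · refine ne_top_of_le_ne_top (lintegral_prod_norm_sub_sq_ne_top
      (integrable_norm_sq_map_affine hσ2 a b) hμ2) (iInf₂_le _ ⟨?_, ?_⟩)
    · simp [Measure.map_fst_prod]
    · simp [Measure.map_snd_prod]
  simp_rw [ENNReal.mul_iInf_of_ne (a := 4) (by simp) (by simp)]
  refine le_iInf₂ fun π hπ ↦ ?_
  set X : Rn n × Rn n → Rn n := fun p ↦ a⁻¹ • (p.1 - b) with hXdef
  have hX : Measurable X := by fun_prop
  have hSX (p : Rn n × Rn n) : a • X p + b = p.1 := by
    simp [hXdef, smul_smul, mul_inv_cancel₀ ha.ne']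
  have hXσ : π.map X = σ := by
    have hinv : Measurable fun x : Rn n ↦ a⁻¹ • (x - b) := by fun_prop
    have h : π.map X = (π.map Prod.fst).map fun x ↦ a⁻¹ • (x - b) := by
      rw [Measure.map_map hinv measurable_fst]
      rfl
    rw [h, hπ.1, Measure.map_map hinv hS]
    convert Measure.map_id
    ext1 x
    simp [smul_smul, inv_mul_cancel₀ ha.ne']
  have hmeas : Measurable fun p : Rn n × Rn n ↦ (smMap σ μ θ (X p), p.2) := by fun_prop
  have hfst : (π.map fun p ↦ (smMap σ μ θ (X p), p.2)).map Prod.fst = σ.map (smMap σ μ θ) := by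
    rw [Measure.map_map measurable_fst hmeas, ← hXσ, Measure.map_map (by rwa [hXσ]) hX, hXσ]
    rfl
  have hsnd : (π.map fun p ↦ (smMap σ μ θ (X p), p.2)).map Prod.snd = μ := by
    rw [Measure.map_map measurable_snd hmeas]
    exact hπ.2
  refine (iInf₂_le _ ⟨hfst, hsnd⟩).trans ?_
  have key := lintegral_norm_sub_smMap_le π σ μ hac hθ hX measurable_snd hXσ hπ.2 ha b
  simp_rw [hSX] at key
  rw [lintegral_map (by fun_prop) hmeas]
  calc ∫⁻ p, ENNReal.ofReal (‖smMap σ μ θ (X p) - p.2‖ ^ 2) ∂π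
      ≤ ∫⁻ p, (2 * ENNReal.ofReal (‖p.1 - smMap σ μ θ (X p)‖ ^ 2) +
          2 * ENNReal.ofReal (‖p.1 - p.2‖ ^ 2)) ∂π :=
        lintegral_mono fun p ↦ ofReal_norm_sub_sq_le _ _ _
    _ = 2 * ∫⁻ p, ENNReal.ofReal (‖p.1 - smMap σ μ θ (X p)‖ ^ 2) ∂π +
          2 * ∫⁻ p, ENNReal.ofReal (‖p.1 - p.2‖ ^ 2) ∂π := by
        rw [lintegral_add_left (by fun_prop), lintegral_const_mul _ (by fun_prop),
          lintegral_const_mul _ (by fun_prop)]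
    _ ≤ 2 * ∫⁻ p, ENNReal.ofReal (‖p.1 - p.2‖ ^ 2) ∂π +
          2 * ∫⁻ p, ENNReal.ofReal (‖p.1 - p.2‖ ^ 2) ∂π := by gcongr
    _ = 4 * ∫⁻ p, ENNReal.ofReal (‖p.1 - p.2‖ ^ 2) ∂π := by
        rw [← add_mul]
        norm_num

end Euclidean

/-- One step of matrix-slice matching approximates the target measure up
to twice the best translation-and-scaling alignment error in `W₂`. -/
theorem stmt9 {n : ℕ}
    (σ μ : Measure (Rn n)) [IsProbabilityMeasure σ] [IsProbabilityMeasure μ]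
    (hac : σ ≪ volume)
    (hσ2 : Integrable (fun x => ‖x‖ ^ 2) σ) (hμ2 : Integrable (fun y => ‖y‖ ^ 2) μ)
    (θ : Fin n → Rn n) (hθ : Orthonormal ℝ θ) :
    W2 (σ.map (smMap σ μ θ)) μ ≤
      2 * sInf {r : ℝ | ∃ a : ℝ, 0 < a ∧ ∃ b : Rn n,
        r = W2 (σ.map (fun x => a • x + b)) μ} := by
  rw [← div_le_iff₀' two_pos]
  refine le_csInf ⟨_, 1, one_pos, 0, rfl⟩ ?_
  rintro r ⟨a, ha, b, rfl⟩
  rw [div_le_iff₀' two_pos]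
  exact W2_map_smMap_le hac hσ2 hμ2 hθ ha b

end SliceMatching
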